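/- The trace language L of a shared multi-set with deletion rights satisfies the three Process-Commutative-Object language properties: (i) Initial emptiness: the empty word belongs to L; (ii) C*-closure: for every word v ∈ L and every element e ∈ E, v ⊕ add_e ∈ L; (iii) I-diamond closure: for every word v ∈ L, every process index i, every element e_i ∈ E_i, and every word z over Σ \ O_i, if v ⊕ delete_{e_i} ∈ L and v ⊕ z ∈ L, then v ⊕ z ⊕ delete_{e_i} ∈ L. -/

import Mathlib

/-!
Shared multi-set with deletion rights.
Elements `E`, partition of `E` into sets `E_i` encoded by `owner : E → Fin n`
(`E_i = owner ⁻¹' {i}`).  Alphabet `Σ`: common updates `add e` (e ∈ E),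
process-exclusive updates `O_i = { delete e | owner e = i }`.
`getSet v e = #add_e(v) − #delete_e(v)` and `L = { v | ∀ e, getSet v e ≥ 0 }`.
-/

inductive MSOp (E : Type*) where
  | add : E → MSOp E
  | delete : E → MSOp E
deriving DecidableEq

/-- `getSet(v)(e)`: multiplicity of `e` after the word `v`. -/
def getSet {E : Type*} [DecidableEq E] (v : List (MSOp E)) (e : E) : ℤ :=
  (v.count (MSOp.add e) : ℤ) - (v.count (MSOp.delete e) : ℤ)

/-- The trace language `L` of the shared multi-set. -/
def msL {E : Type*} [DecidableEq E] (v : List (MSOp E)) : Prop :=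
  ∀ e : E, 0 ≤ getSet v e

/-- The language `L` of a shared multi-set with deletion rights satisfies
(i) initial emptiness, (ii) `C*`-closure, and (iii) `I`-diamond closure. -/
theorem multiset_language_is_PCO {E : Type*} [DecidableEq E] {n : ℕ}
    (owner : E → Fin n) :
    -- (i) Initial emptiness
    msL ([] : List (MSOp E)) ∧
    -- (ii) C*-closure: appending any common update `add e` preserves L
    (∀ v : List (MSOp E), msL v → ∀ e : E, msL (v ++ [MSOp.add e])) ∧
    -- (iii) I-diamond closure
    (∀ v : List (MSOp E), msL v →
      ∀ (i : Fin n) (e : E), owner e = i →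
      ∀ z : List (MSOp E),
        (∀ a ∈ z, ∀ e' : E, a = MSOp.delete e' → owner e' ≠ i) →
        msL (v ++ [MSOp.delete e]) → msL (v ++ z) →
        msL (v ++ z ++ [MSOp.delete e])) := by
  refine ⟨fun e => by simp [getSet], fun v hv e x => ?_, fun v _ i e he z hz h1 h2 x => ?_⟩
  · have hx := hv x
    simp only [getSet, List.count_append, List.count_singleton] at hx ⊢
    have h : ((MSOp.add e : MSOp E) == MSOp.delete x) = false := by simp
    rw [h]
    push_cast
    split_ifs <;> simp_all <;> omega
  · have a1 := h1 x
    have a2 := h2 x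
    simp only [getSet, List.count_append] at a1 a2 ⊢
    push_cast at a1 a2 ⊢
    by_cases hxe : x = e
    · subst hxe
      have hc : z.count (MSOp.delete x) = 0 :=
        List.count_eq_zero.mpr fun hm => hz _ hm x rfl he
      rw [hc]
      push_cast
      omega
    · have hc : List.count (MSOp.delete x) [MSOp.delete e] = 0 :=
        List.count_eq_zero.mpr (by simpa using hxe)
      rw [hc]
      push_cast
      omega
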